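/- Let (R, m) be a d-dimensional Cohen-Macaulay local ring with isolated singularity (R_p regular for all non-maximal primes p), M a nonfree maximal Cohen-Macaulay R-module, and N a strongly-rigid finitely generated R-module with depth(N) ≥ 2. Then depth(Hom_R(M,N)) = 2. -/

import Mathlib

open CategoryTheory

noncomputable section

variable (R : Type) [CommRing R]

/-- `Ext^n_R(M,N)` as an `R`-module object. -/
abbrev ext (n : ℕ) (M N : ModuleCat R) : ModuleCat R :=
  ((Ext R (ModuleCat R) n).obj (Opposite.op M)).obj N

/-- `Tor_n^R(M,N)`. -/
abbrev tor (n : ℕ) (M N : ModuleCat R) : ModuleCat R :=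
  ((Tor (ModuleCat R) n).obj M).obj N

/-- projective dimension, via vanishing of `Ext` in degrees above `n`. -/
def projDim (M : ModuleCat R) : ℕ∞ :=
  sInf {n : ℕ∞ | ∀ (i : ℕ) (X : ModuleCat R), n < i → Subsingleton (ext R i M X)}

/-- injective dimension, via vanishing of `Ext` in degrees above `n`. -/
def injDim (N : ModuleCat R) : ℕ∞ :=
  sInf {n : ℕ∞ | ∀ (i : ℕ) (X : ModuleCat R), n < i → Subsingleton (ext R i X N)}

/-- depth over a local ring, as the least `n` with `Ext^n(k, N) ≠ 0`. -/
def depth [IsLocalRing R] (N : ModuleCat R) : ℕ∞ :=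
  sInf {n : ℕ∞ | ∃ i : ℕ, n = i ∧
    ¬ Subsingleton (ext R i (ModuleCat.of R (IsLocalRing.ResidueField R)) N)}

/-- Tor-rigidity. -/
def TorRigid (N : ModuleCat R) : Prop :=
  ∀ (X : ModuleCat R), Module.Finite R X → ∀ n : ℕ, 1 ≤ n →
    Subsingleton (tor R n N X) → Subsingleton (tor R (n + 1) N X)

/-- test module for projectivity. -/
def TestModule (M : ModuleCat R) : Prop :=
  ∀ (X : ModuleCat R), Module.Finite R X → projDim R X = ⊤ →
    {j : ℕ | ¬ Subsingleton (tor R j M X)}.Infinite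

/-- strongly-rigid module. -/
def StronglyRigid (N : ModuleCat R) : Prop :=
  ∀ (X : ModuleCat R), Module.Finite R X → ∀ n : ℕ, 1 ≤ n →
    Subsingleton (tor R n N X) → projDim R X < ⊤

/-- rigid-test module. -/
def RigidTest (N : ModuleCat R) : Prop :=
  ∀ (X : ModuleCat R), Module.Finite R X → ∀ n : ℕ, 1 ≤ n →
    Subsingleton (tor R n N X) →
      Subsingleton (tor R (n + 1) N X) ∧ projDim R X < ⊤


noncomputable section
section bridge
variable {S : Type} [CommRing S]

lemma extS_iff (i : ℕ) (M N : ModuleCat S) :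
    Subsingleton (ext S i M N) ↔ Subsingleton (Abelian.Ext M N i) := by
  let P := projectiveResolution M
  have h1 : Subsingleton (ext S i M N) ↔
      Subsingleton ((P.complex.linearYonedaObj S N).homology i : ModuleCat S) :=
    (P.isoExt (R := S) i N).toLinearEquiv.toEquiv.subsingleton_congr
  rw [h1, ← ModuleCat.isZero_iff_subsingleton, ← HomologicalComplex.exactAt_iff_isZero_homology]
  cases i with
  | zero =>
    rw [HomologicalComplex.exactAt_iff' _ 0 0 1 (by simp) (by simp),
      ShortComplex.moduleCat_exact_iff]
    have hd : ((P.complex.linearYonedaObj S N).sc' 0 0 1).f = 0 :=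
      (P.complex.linearYonedaObj S N).shape 0 0 (by simp)
    constructor
    · intro h
      have key : ∀ a : Abelian.Ext M N 0, a = 0 := by
        intro a
        obtain ⟨f, hf, rfl⟩ := P.extMk_surjective a 1 rfl
        obtain ⟨g, hg⟩ := h f hf
        rw [hd] at hg
        have hf0 : f = 0 := hg.symm
        subst hf0
        exact P.extMk_zero 1 rfl
      exact ⟨fun a b => by rw [key a, key b]⟩
    · intro h (f : P.complex.X 0 ⟶ N) (hf : P.complex.d 1 0 ≫ f = 0)
      have hs : Subsingleton (M ⟶ N) := Abelian.Ext.addEquiv₀.subsingleton_congr.mp h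
      have hf2 := P.exact₀.g_desc f hf
      have h0 : P.exact₀.desc f hf = 0 := hs.elim _ _
      rw [h0] at hf2
      refine ⟨0, ?_⟩
      rw [map_zero]
      rw [← hf2]
      simp
      rfl
  | succ n =>
    rw [HomologicalComplex.exactAt_iff' _ n (n+1) (n+2) (by simp) (by simp),
      ShortComplex.moduleCat_exact_iff]
    constructor
    · intro h
      refine ⟨fun a b => ?_⟩
      have key : ∀ a : Abelian.Ext M N (n+1), a = 0 := by
        intro a
        obtain ⟨f, hf, rfl⟩ := P.extMk_surjective a (n+2) rfl
        rw [P.extMk_eq_zero_iff f (n+2) rfl hf n rfl]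
        exact h f hf
      rw [key a, key b]
    · intro h f hf
      have := (P.extMk_eq_zero_iff (Y := N) f (n+2) rfl hf n rfl).1 (Subsingleton.elim _ _)
      exact this
end bridge
end

noncomputable section
section toolkit
variable {S : Type} [CommRing S]
variable {A B C X Y Z : Type} [AddCommGroup A] [Module S A] [AddCommGroup B] [Module S B]
  [AddCommGroup C] [Module S C] [AddCommGroup X] [Module S X] [AddCommGroup Y] [Module S Y]
  [AddCommGroup Z] [Module S Z]

variable (S X Y) in
/-- vanishing of `Ext^i(X, Y)`. -/
def EV (i : ℕ) : Prop :=
  Subsingleton (Abelian.Ext (ModuleCat.of S X) (ModuleCat.of S Y) i)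

lemma shortEx {f : A →ₗ[S] B} {g : B →ₗ[S] C} (hf : Function.Injective f)
    (hfg : Function.Exact f g) (hg : Function.Surjective g) :
    (ShortComplex.mk (ModuleCat.ofHom f) (ModuleCat.ofHom g)
      (by rw [← ModuleCat.ofHom_comp, hfg.linearMap_comp_eq_zero]; rfl)).ShortExact where
  exact := by
    rw [ShortComplex.ShortExact.moduleCat_exact_iff_function_exact]
    exact hfg
  mono_f := (ModuleCat.mono_iff_injective _).2 hf
  epi_g := (ModuleCat.epi_iff_surjective _).2 hg

lemma EV.of_forall {i : ℕ}
    (h : ∀ x : Abelian.Ext (ModuleCat.of S X) (ModuleCat.of S Y) i, x = 0) : EV S X Y i :=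
  ⟨fun a b => by rw [h a, h b]⟩

lemma EV.eq_zero {i : ℕ} (h : EV S X Y i)
    (x : Abelian.Ext (ModuleCat.of S X) (ModuleCat.of S Y) i) : x = 0 := h.elim _ _

section
lemma EV.mid {f : A →ₗ[S] B} {g : B →ₗ[S] C} (hf : Function.Injective f)
    (hfg : Function.Exact f g) (hg : Function.Surjective g) {i : ℕ}
    (h1 : EV S X A i) (h2 : EV S X C i) : EV S X B i := by
  refine EV.of_forall fun x => ?_
  obtain ⟨y, hy⟩ := Abelian.Ext.covariant_sequence_exact₂ _ (shortEx hf hfg hg) x (h2.eq_zero _)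
  rw [← hy, h1.eq_zero y, Abelian.Ext.zero_comp]

lemma EV.right {f : A →ₗ[S] B} {g : B →ₗ[S] C} (hf : Function.Injective f)
    (hfg : Function.Exact f g) (hg : Function.Surjective g) {i : ℕ}
    (h1 : EV S X B i) (h2 : EV S X A (i+1)) : EV S X C i := by
  refine EV.of_forall fun x => ?_
  obtain ⟨y, hy⟩ := Abelian.Ext.covariant_sequence_exact₃ _ (shortEx hf hfg hg) x rfl
    (h2.eq_zero _)
  rw [← hy, h1.eq_zero y, Abelian.Ext.zero_comp]

lemma EV.left {f : A →ₗ[S] B} {g : B →ₗ[S] C} (hf : Function.Injective f)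
    (hfg : Function.Exact f g) (hg : Function.Surjective g) {i : ℕ}
    (h1 : EV S X C i) (h2 : EV S X B (i+1)) : EV S X A (i+1) := by
  refine EV.of_forall fun x => ?_
  obtain ⟨y, hy⟩ := Abelian.Ext.covariant_sequence_exact₁ _ (shortEx hf hfg hg) x
    (h2.eq_zero _) rfl
  rw [← hy, h1.eq_zero y, Abelian.Ext.zero_comp]

lemma EV.cmid {f : A →ₗ[S] B} {g : B →ₗ[S] C} (hf : Function.Injective f)
    (hfg : Function.Exact f g) (hg : Function.Surjective g) {i : ℕ}
    (h1 : EV S A Y i) (h2 : EV S C Y i) : EV S B Y i := by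
  refine EV.of_forall fun x => ?_
  obtain ⟨y, hy⟩ := Abelian.Ext.contravariant_sequence_exact₂ (shortEx hf hfg hg) _ x
    (h1.eq_zero _)
  rw [← hy, h2.eq_zero y, Abelian.Ext.comp_zero]

lemma EV.cleft {f : A →ₗ[S] B} {g : B →ₗ[S] C} (hf : Function.Injective f)
    (hfg : Function.Exact f g) (hg : Function.Surjective g) {i : ℕ}
    (h1 : EV S B Y i) (h2 : EV S C Y (i+1)) : EV S A Y i := by
  refine EV.of_forall fun x => ?_
  obtain ⟨y, hy⟩ := Abelian.Ext.contravariant_sequence_exact₁ (shortEx hf hfg hg) _ x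
    (add_comm 1 i) (h2.eq_zero _)
  rw [← hy, h1.eq_zero y, Abelian.Ext.comp_zero]

lemma EV.cright {f : A →ₗ[S] B} {g : B →ₗ[S] C} (hf : Function.Injective f)
    (hfg : Function.Exact f g) (hg : Function.Surjective g) {i : ℕ}
    (h1 : EV S A Y i) (h2 : EV S B Y (i+1)) : EV S C Y (i+1) := by
  refine EV.of_forall fun x => ?_
  obtain ⟨y, hy⟩ := Abelian.Ext.contravariant_sequence_exact₃ (shortEx hf hfg hg) _ x
    (h2.eq_zero _) (add_comm 1 i)
  rw [← hy, h1.eq_zero y, Abelian.Ext.comp_zero]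

/-- if `Ext^{i+1}(C,Y) = 0` then `Ext^i(B,Y) → Ext^i(A,Y)` is surjective. -/
lemma ext_precomp_surj {f : A →ₗ[S] B} {g : B →ₗ[S] C} (hf : Function.Injective f)
    (hfg : Function.Exact f g) (hg : Function.Surjective g) {i : ℕ}
    (h2 : EV S C Y (i+1))
    (x : Abelian.Ext (ModuleCat.of S A) (ModuleCat.of S Y) i) :
    ∃ y : Abelian.Ext (ModuleCat.of S B) (ModuleCat.of S Y) i,
      (Abelian.Ext.mk₀ (ModuleCat.ofHom f)).comp y (zero_add i) = x :=
  Abelian.Ext.contravariant_sequence_exact₁ (shortEx hf hfg hg) _ x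
    (add_comm 1 i) (h2.eq_zero _)

/-- if `Ext^{i}(X,C) = 0` then `Ext^{i+1}(X,A) → Ext^{i+1}(X,B)` is injective. -/
lemma ext_postcomp_inj {f : A →ₗ[S] B} {g : B →ₗ[S] C} (hf : Function.Injective f)
    (hfg : Function.Exact f g) (hg : Function.Surjective g) {i : ℕ}
    (h1 : EV S X C i)
    (x : Abelian.Ext (ModuleCat.of S X) (ModuleCat.of S A) (i+1))
    (hx : x.comp (Abelian.Ext.mk₀ (ModuleCat.ofHom f)) (add_zero (i+1)) = 0) : x = 0 := by
  obtain ⟨y, hy⟩ := Abelian.Ext.covariant_sequence_exact₁ _ (shortEx hf hfg hg) x hx rfl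
  rw [← hy, h1.eq_zero y, Abelian.Ext.zero_comp]
end

lemma EV.zero_iff : EV S X Y 0 ↔ Subsingleton (X →ₗ[S] Y) :=
  (Abelian.Ext.addEquiv₀.trans ModuleCat.homAddEquiv).subsingleton_congr

lemma EV.of_retract {i : ℕ} (f : A →ₗ[S] B) (g : B →ₗ[S] A) (h : g ∘ₗ f = LinearMap.id)
    (hB : EV S X B i) : EV S X A i := by
  refine EV.of_forall fun x => ?_
  have h1 : ModuleCat.ofHom f ≫ ModuleCat.ofHom g = 𝟙 (ModuleCat.of S A) := by
    rw [← ModuleCat.ofHom_comp, h]; rfl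
  rw [← x.comp_mk₀_id, ← h1, ← Abelian.Ext.mk₀_comp_mk₀, ← Abelian.Ext.comp_assoc_of_third_deg_zero,
    hB.eq_zero (x.comp _ _), Abelian.Ext.zero_comp]

lemma EV.of_retract' {i : ℕ} (f : A →ₗ[S] B) (g : B →ₗ[S] A) (h : g ∘ₗ f = LinearMap.id)
    (hB : EV S B Y i) : EV S A Y i := by
  refine EV.of_forall fun x => ?_
  have h1 : ModuleCat.ofHom f ≫ ModuleCat.ofHom g = 𝟙 (ModuleCat.of S A) := by
    rw [← ModuleCat.ofHom_comp, h]; rfl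
  rw [← x.mk₀_id_comp, ← h1, ← Abelian.Ext.mk₀_comp_mk₀, Abelian.Ext.comp_assoc_of_second_deg_zero,
    hB.eq_zero (Abelian.Ext.comp _ x _), Abelian.Ext.comp_zero]

lemma EV.congr {i : ℕ} (e : A ≃ₗ[S] B) (hB : EV S X B i) : EV S X A i :=
  hB.of_retract e.toLinearMap e.symm.toLinearMap (by ext; simp)

lemma EV.congr' {i : ℕ} (e : A ≃ₗ[S] B) (hB : EV S B Y i) : EV S A Y i :=
  hB.of_retract' e.toLinearMap e.symm.toLinearMap (by ext; simp)

lemma EV.pi {i n : ℕ} (h : EV S X Y i) : EV S X (Fin n → Y) i := by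
  induction n with
  | zero =>
    refine EV.of_forall fun x => ?_
    have h1 : 𝟙 (ModuleCat.of S (Fin 0 → Y)) = 0 := by
      apply ModuleCat.hom_ext
      apply LinearMap.ext
      intro y
      exact Subsingleton.elim (α := Fin 0 → Y) _ _
    rw [← x.comp_mk₀_id, h1, Abelian.Ext.mk₀_zero, Abelian.Ext.comp_zero]
  | succ n ih =>
    have h2 : EV S X (Y × (Fin n → Y)) i :=
      EV.mid (f := LinearMap.inl S Y (Fin n → Y)) (g := LinearMap.snd S Y (Fin n → Y))
        LinearMap.inl_injective Function.Exact.inl_snd LinearMap.snd_surjective h ih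
    exact h2.congr (Fin.consLinearEquiv S (fun _ : Fin (n+1) => Y)).symm

lemma EV.free {i : ℕ} [Module.Free S A] [Module.Finite S A] (h : EV S X S i) : EV S X A i := by
  cases subsingleton_or_nontrivial S
  · exact (h.pi (n := 0)).congr
      { toFun := 0, invFun := 0, map_add' := by simp, map_smul' := by simp,
        left_inv := fun x => (Module.subsingleton S A).elim _ _,
        right_inv := fun x => Subsingleton.elim _ _ }
  · exact h.pi.congr (Module.finBasis S A).equivFun

lemma EV.proj {i : ℕ} [Module.Projective S A] : EV S A Y (i+1) :=
  EV.of_forall fun x => Abelian.Ext.eq_zero_of_projective x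

lemma EV.one_iff [Module.Projective S B] {f : A →ₗ[S] B} {g : B →ₗ[S] C}
    (hf : Function.Injective f)
    (hfg : Function.Exact f g) (hg : Function.Surjective g) :
    EV S C Y 1 ↔ ∀ φ : A →ₗ[S] Y, ∃ ψ : B →ₗ[S] Y, ψ ∘ₗ f = φ := by
  constructor
  · intro h φ
    obtain ⟨y, hy⟩ := ext_precomp_surj hf hfg hg h (Abelian.Ext.mk₀ (ModuleCat.ofHom φ))
    obtain ⟨z, rfl⟩ := Abelian.Ext.addEquiv₀.symm.surjective y
    refine ⟨z.hom, ?_⟩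
    simp only [Abelian.Ext.addEquiv₀_symm_apply, Abelian.Ext.mk₀_comp_mk₀] at hy
    have := Abelian.Ext.addEquiv₀.symm.injective hy
    have := congrArg ModuleCat.Hom.hom this
    simpa using this
  · intro h
    refine EV.of_forall fun x => ?_
    obtain ⟨y, hy⟩ := Abelian.Ext.contravariant_sequence_exact₃ (shortEx hf hfg hg) _ x
      (EV.proj.eq_zero _) (add_zero 1)
    obtain ⟨z, rfl⟩ := Abelian.Ext.addEquiv₀.symm.surjective y
    obtain ⟨ψ, hψ⟩ := h z.hom
    have hz : z = ModuleCat.ofHom f ≫ ModuleCat.ofHom ψ :=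
      (congrArg ModuleCat.ofHom hψ).symm
    rw [← hy, Abelian.Ext.addEquiv₀_symm_apply, hz, ← Abelian.Ext.mk₀_comp_mk₀,
      ← Abelian.Ext.comp_assoc_of_second_deg_zero]
    rw [(shortEx hf hfg hg).extClass_comp, Abelian.Ext.zero_comp]
end toolkit
end

noncomputable section
section ischebeck
set_option linter.unusedSectionVars false
variable {S : Type} [CommRing S] [IsNoetherianRing S] [IsLocalRing S]

open IsLocalRing

variable (S) in
/-- depth at least `n`. -/
def DG (Y : Type) [AddCommGroup Y] [Module S Y] (n : ℕ) : Prop :=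
  ∀ i < n, EV S (ResidueField S) Y i

lemma ev_of_primes {Y : Type} [AddCommGroup Y] [Module S Y] {i : ℕ}
    (X : Type) [AddCommGroup X] [Module S X] [Module.Finite S X]
    (h : ∀ q : PrimeSpectrum S, Module.annihilator S X ≤ q.asIdeal → EV S (S ⧸ q.asIdeal) Y i) :
    EV S X Y i := by
  induction (inferInstance : Module.Finite S X) using
    IsNoetherianRing.induction_on_isQuotientEquivQuotientPrime with
  | subsingleton N =>
    refine EV.of_forall fun x => ?_
    have h1 : 𝟙 (ModuleCat.of S N) = 0 := by
      apply ModuleCat.hom_ext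
      apply LinearMap.ext
      intro y
      exact Subsingleton.elim (α := N) _ _
    rw [← x.mk₀_id_comp, h1, Abelian.Ext.mk₀_zero, Abelian.Ext.zero_comp]
  | quotient N p e =>
    refine EV.congr' e (h p ?_)
    rw [e.annihilator_eq, Ideal.annihilator_quotient]
  | exact N₁ N₂ N₃ f g hf hg hfg h1 h3 =>
    refine EV.cmid hf hfg hg (h1 fun q hq => h q ?_) (h3 fun q hq => h q ?_)
    · exact (LinearMap.annihilator_le_of_injective f hf).trans hq
    · exact (LinearMap.annihilator_le_of_surjective g hg).trans hq

lemma nak {E : Type} [AddCommGroup E] [Module S E] [Module.Finite S E] (x : S)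
    (hx : x ∈ maximalIdeal S) (h : ∀ e : E, ∃ e', x • e' = e) : Subsingleton E := by
  have h1 : (⊤ : Submodule S E) = ⊥ := by
    apply Submodule.eq_bot_of_le_smul_of_le_jacobson_bot (maximalIdeal S) ⊤ Module.Finite.fg_top
    · intro e _
      obtain ⟨e', rfl⟩ := h e
      exact Submodule.smul_mem_smul hx trivial
    · rw [IsLocalRing.jacobson_eq_maximalIdeal ⊥ bot_ne_top]
  exact (Submodule.subsingleton_iff S).1 (subsingleton_of_bot_eq_top h1.symm)

lemma ischebeck {Y : Type} [AddCommGroup Y] [Module S Y] [Module.Finite S Y] {n : ℕ}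
    (hY : DG S Y n) (t : ℕ) : ∀ p : PrimeSpectrum S, Order.coheight p ≤ t → ∀ i, i + t < n →
      EV S (S ⧸ p.asIdeal) Y i := by
  induction t with
  | zero =>
    intro p hp i hi
    have hm : IsMax p := by simpa using hp
    have h1 : closedPoint S = p := (PrimeSpectrum.le_iff_specializes _ _).2
      ((specializes_closedPoint p)) |>.antisymm' (hm ((PrimeSpectrum.le_iff_specializes _ _).2
      ((specializes_closedPoint p)))) 
    subst h1
    exact hY i (by simpa using hi)
  | succ t ih =>
    intro p hp i hi
    by_cases hpm : p = closedPoint S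
    · subst hpm
      exact hY i (by omega)
    have hle : p.asIdeal ≤ maximalIdeal S := le_maximalIdeal p.2.ne_top
    have hnle : ¬ maximalIdeal S ≤ p.asIdeal := fun h => hpm (PrimeSpectrum.ext (le_antisymm hle h))
    obtain ⟨x, hxm, hxp⟩ := SetLike.not_le_iff_exists.1 hnle
    let f : (S ⧸ p.asIdeal) →ₗ[S] (S ⧸ p.asIdeal) := x • LinearMap.id
    have hf : Function.Injective f := by
      rw [← LinearMap.ker_eq_bot, LinearMap.ker_eq_bot']
      intro y hy
      obtain ⟨y, rfl⟩ := Ideal.Quotient.mk_surjective y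
      have : Ideal.Quotient.mk p.asIdeal (x * y) = 0 := hy
      rw [Ideal.Quotient.eq_zero_iff_mem] at this ⊢
      exact (p.2.mem_or_mem this).resolve_left hxp
    have hX : EV S ((S ⧸ p.asIdeal) ⧸ LinearMap.range f) Y (i+1) := by
      apply ev_of_primes
      intro q hq
      apply ih
      · have hpq : p < q := by
          refine lt_of_le_of_ne ?_ ?_
          · intro a ha
            apply hq
            have := LinearMap.annihilator_le_of_surjective (LinearMap.range f).mkQ
              (Submodule.mkQ_surjective _)
            apply this
            rw [Ideal.annihilator_quotient]
            exact ha
          · rintro rfl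
            apply hxp
            apply hq
            rw [Module.mem_annihilator]
            intro y
            obtain ⟨y, rfl⟩ := Submodule.mkQ_surjective _ y
            rw [← map_smul]
            simp only [Submodule.mkQ_apply, Submodule.Quotient.mk_eq_zero]
            exact ⟨y, rfl⟩
        have h2 := (Order.coheight_add_one_le hpq).trans hp
        push_cast at h2
        exact (ENat.add_le_add_iff_right (by simp)).1 h2
      · omega
    refine nak x hxm ?_
    intro e
    obtain ⟨e', he'⟩ := ext_precomp_surj hf (LinearMap.exact_map_mkQ_range f)
      (Submodule.mkQ_surjective _) hX e
    refine ⟨e', ?_⟩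
    rw [← he']
    have : ModuleCat.ofHom f = x • 𝟙 _ := rfl
    rw [this]
    simp [Abelian.Ext.mk₀_smul]

lemma depth_le_dim {Y : Type} [AddCommGroup Y] [Module S Y] [Module.Finite S Y] [Nontrivial Y]
    {n : ℕ} (hY : DG S Y n) : (n : WithBot ℕ∞) ≤ ringKrullDim S := by
  obtain ⟨q, hq⟩ := associatedPrimes.nonempty S Y
  by_contra hlt
  rw [not_le] at hlt
  have h1 := (Order.coheight_le_krullDim (⟨q, hq.1⟩ : PrimeSpectrum S)).trans_lt hlt
  have h2 : Order.coheight (⟨q, hq.1⟩ : PrimeSpectrum S) < n := by exact_mod_cast h1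
  obtain ⟨t, ht⟩ := ENat.ne_top_iff_exists.1 (h2.trans (ENat.natCast_lt_top n)).ne
  have := ischebeck hY t ⟨q, hq.1⟩ ht.symm.le 0 (by rw [← ht] at h2; have : t < n := by exact_mod_cast h2
                                                    omega)
  rw [EV.zero_iff] at this
  obtain ⟨f, hf⟩ := (isAssociatedPrime_iff_exists_injective_linearMap q Y).1 hq |>.2
  have hf0 : f = 0 := this.elim _ _
  subst hf0
  have h3 : (1 : S ⧸ q) = 0 := hf rfl
  have := hq.1
  exact one_ne_zero h3
end ischebeck
end

noncomputable section
section ab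
set_option linter.unusedSectionVars false
variable {S : Type} [CommRing S] [IsNoetherianRing S] [IsLocalRing S]
variable {A G Y : Type} [AddCommGroup A] [Module S A] [AddCommGroup G] [Module S G]
  [AddCommGroup Y] [Module S Y]

open IsLocalRing

lemma smul_ext_res {i : ℕ} (r : S) (hr : r ∈ maximalIdeal S)
    (x : Abelian.Ext (ModuleCat.of S (ResidueField S)) (ModuleCat.of S Y) i) : r • x = 0 := by
  have h0 : r • 𝟙 (ModuleCat.of S (ResidueField S)) = 0 := by
    apply ModuleCat.hom_ext
    apply LinearMap.ext
    intro (y : ResidueField S)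
    change r • y = 0
    rw [Algebra.smul_def, ResidueField.algebraMap_eq, (residue_eq_zero_iff r).2 hr, zero_mul]
  have smul_eq : r • x = (Abelian.Ext.mk₀ (r • 𝟙 (ModuleCat.of S (ResidueField S)))).comp x
    (zero_add i) := by simp [Abelian.Ext.mk₀_smul]
  rw [smul_eq, h0, Abelian.Ext.mk₀_zero, Abelian.Ext.zero_comp]

lemma ext_comp_span {i : ℕ} (x : Abelian.Ext (ModuleCat.of S (ResidueField S)) (ModuleCat.of S S) i)
    (g : G) (hg : g ∈ maximalIdeal S • (⊤ : Submodule S G)) :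
    x.comp (Abelian.Ext.mk₀ (ModuleCat.ofHom (LinearMap.toSpanSingleton S G g))) (add_zero i) = 0 := by
  induction hg using Submodule.smul_induction_on' with
  | smul r hr n hn =>
    have : ModuleCat.ofHom (LinearMap.toSpanSingleton S G (r • n)) =
      r • ModuleCat.ofHom (LinearMap.toSpanSingleton S G n) := by
      apply ModuleCat.hom_ext
      apply LinearMap.ext
      intro y
      change y • r • n = r • y • n
      rw [smul_comm]
    rw [this, Abelian.Ext.mk₀_smul, Abelian.Ext.comp_smul]
    exact smul_ext_res r hr _
  | add a ha b hb h1 h2 =>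
    have : ModuleCat.ofHom (LinearMap.toSpanSingleton S G (a + b)) =
      ModuleCat.ofHom (LinearMap.toSpanSingleton S G a) +
      ModuleCat.ofHom (LinearMap.toSpanSingleton S G b) := by
      apply ModuleCat.hom_ext
      apply LinearMap.ext
      intro y
      change y • (a + b) = y • a + y • b
      rw [smul_add]
    rw [this, Abelian.Ext.mk₀_add, Abelian.Ext.comp_add, h1, h2, add_zero]

lemma ab1 [Module.Free S A] [Module.Finite S A] [Module.Free S G] [Module.Finite S G]
    {f : A →ₗ[S] G} {g : G →ₗ[S] Y} (hf : Function.Injective f)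
    (hfg : Function.Exact f g) (hg : Function.Surjective g) {s : ℕ}
    (hs : ¬ EV S (ResidueField S) S s) (hY : DG S Y s) : Module.Free S Y := by
  refine Module.free_of_lTensor_residueField_injective f g hg hfg ?_
  have hinj : ∀ x : Abelian.Ext (ModuleCat.of S (ResidueField S)) (ModuleCat.of S A) s,
      x.comp (Abelian.Ext.mk₀ (ModuleCat.ofHom f)) (add_zero s) = 0 → x = 0 := by
    cases s with
    | zero =>
      intro x hx
      have : Mono (ModuleCat.ofHom f) := (ModuleCat.mono_iff_injective _).2 hf
      refine Abelian.Ext.postcomp_mk₀_injective_of_mono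
        (ModuleCat.of S (ResidueField S)) (ModuleCat.ofHom f) ?_
      rw [map_zero]
      exact hx
    | succ i =>
      intro x hx
      exact ext_postcomp_inj hf hfg hg (hY i (by omega)) x hx
  rw [← LinearMap.ker_eq_bot, LinearMap.ker_eq_bot']
  intro z hz
  obtain ⟨a, rfl⟩ := TensorProduct.mk_surjective S A (ResidueField S) residue_surjective z
  have h1 : f a ∈ maximalIdeal S • (⊤ : Submodule S G) := by
    rw [← LinearMap.ker_tensorProductMk]
    exact hz
  by_contra hne
  have h2 : a ∉ maximalIdeal S • (⊤ : Submodule S A) := by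
    rw [← LinearMap.ker_tensorProductMk]
    exact hne
  let b := Module.finBasis S A
  obtain ⟨j, hj⟩ : ∃ j, b.repr a j ∉ maximalIdeal S := by
    by_contra! hall
    apply h2
    rw [← b.sum_repr a]
    exact Submodule.sum_mem _ fun j _ => Submodule.smul_mem_smul (hall j) trivial
  have hu : IsUnit (b.coord j a) := by
    simpa using hj
  apply hs
  refine EV.of_forall fun x => ?_
  have h3 : x.comp (Abelian.Ext.mk₀ (ModuleCat.ofHom (LinearMap.toSpanSingleton S A a)))
      (add_zero s) = 0 := by
    apply hinj
    rw [Abelian.Ext.comp_assoc_of_third_deg_zero, Abelian.Ext.mk₀_comp_mk₀, ← ModuleCat.ofHom_comp]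
    have : f ∘ₗ LinearMap.toSpanSingleton S A a = LinearMap.toSpanSingleton S G (f a) := by
      ext; simp
    rw [this]
    exact ext_comp_span x _ h1
  have h4 : x.comp (Abelian.Ext.mk₀ (ModuleCat.ofHom (b.coord j ∘ₗ LinearMap.toSpanSingleton S A a)))
      (add_zero s) = 0 := by
    rw [ModuleCat.ofHom_comp, ← Abelian.Ext.mk₀_comp_mk₀, ← Abelian.Ext.comp_assoc_of_third_deg_zero,
      h3, Abelian.Ext.zero_comp]
  have h5 : ModuleCat.ofHom (b.coord j ∘ₗ LinearMap.toSpanSingleton S A a) =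
      (b.coord j a) • 𝟙 (ModuleCat.of S S) := by
    apply ModuleCat.hom_ext
    apply LinearMap.ext
    intro (y : S)
    change b.coord j (y • a) = b.coord j a • y
    rw [map_smul, smul_eq_mul, smul_eq_mul, mul_comm]
  rw [h5, Abelian.Ext.mk₀_smul, Abelian.Ext.comp_smul, Abelian.Ext.comp_mk₀_id] at h4
  exact hu.smul_eq_zero.1 h4

/-- a finite free presentation of a finite module -/
lemma exists_pres (Y : Type) [AddCommGroup Y] [Module S Y] [Module.Finite S Y] :
    ∃ (n : ℕ) (g : (Fin n → S) →ₗ[S] Y), Function.Surjective g :=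
  Module.Finite.exists_fin' S Y

lemma DG.ker {G : Type} [AddCommGroup G] [Module S G] [Module.Free S G] [Module.Finite S G]
    {s t : ℕ} (hS : DG S S s) (hts : t ≤ s) (hY : ∀ j, j + 1 < t → EV S (ResidueField S) Y j)
    (g : G →ₗ[S] Y) (hg : Function.Surjective g) : DG S (LinearMap.ker g) t := by
  intro i hi
  cases i with
  | zero =>
    have h := (hS 0 (by omega)).free (A := G)
    rw [EV.zero_iff] at h ⊢
    refine ⟨fun a b => ?_⟩
    ext x
    exact congrArg (fun F => F x) (h.elim ((LinearMap.ker g).subtype ∘ₗ a)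
      ((LinearMap.ker g).subtype ∘ₗ b))
  | succ j =>
    exact EV.left (LinearMap.ker g).injective_subtype (LinearMap.exact_subtype_ker_map g) hg
      (hY j hi) (hS (j+1) (by omega)).free

lemma DG.mono {s t : ℕ} (hY : DG S Y s) (h : t ≤ s) : DG S Y t := fun i hi => hY i (by omega)

lemma pd_ker {S : Type} [CommRing S] {G Y : Type} [AddCommGroup G] [Module S G]
    [AddCommGroup Y] [Module S Y] [Module.Free S G] (g : G →ₗ[S] Y) (hg : Function.Surjective g)
    (n : ℕ) :
    HasProjectiveDimensionLT (ModuleCat.of S Y) (n + 2) ↔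
    HasProjectiveDimensionLT (ModuleCat.of S (LinearMap.ker g)) (n + 1) :=
  (shortEx (LinearMap.ker g).injective_subtype (LinearMap.exact_subtype_ker_map g)
    hg).hasProjectiveDimensionLT_X₃_iff n
      (inferInstanceAs (Projective (ModuleCat.of S G)))

lemma pd_proj {S : Type} [CommRing S] {Y : Type} [AddCommGroup Y] [Module S Y]
    (h : HasProjectiveDimensionLT (ModuleCat.of S Y) 1) : Module.Projective S Y := by
  rw [← projective_iff_hasProjectiveDimensionLT_one, ← IsProjective.iff_projective] at h
  exact h

lemma proj_pd {S : Type} [CommRing S] {Y : Type} [AddCommGroup Y] [Module S Y]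
    (h : Module.Projective S Y) : HasProjectiveDimensionLT (ModuleCat.of S Y) 1 := by
  rw [← projective_iff_hasProjectiveDimensionLT_one, ← IsProjective.iff_projective]
  exact h

lemma ab {s : ℕ} (hS : DG S S s) (hs : ¬ EV S (ResidueField S) S s) (n : ℕ) :
    ∀ (Y : Type) [AddCommGroup Y] [Module S Y] [Module.Finite S Y], DG S Y s →
    HasProjectiveDimensionLT (ModuleCat.of S Y) (n+1) → Module.Free S Y := by
  induction n with
  | zero =>
    intro Y _ _ _ hY h
    have := pd_proj h
    exact Module.free_of_flat_of_isLocalRing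
  | succ n ih =>
    intro Y _ _ _ hY h
    obtain ⟨m, g, hg⟩ := exists_pres (S := S) Y
    have h1 := (pd_ker g hg n).1 h
    have : Module.Free S (LinearMap.ker g) :=
      ih _ (DG.ker hS le_rfl (fun j hj => hY j (by omega)) g hg) h1
    exact ab1 (LinearMap.ker g).injective_subtype (LinearMap.exact_subtype_ker_map g) hg hs hY

/-- finite projective dimension is at most the depth -/
lemma pd_le {s : ℕ} (hS : DG S S s) (hs : ¬ EV S (ResidueField S) S s) (n e : ℕ) (he : e ≤ s) :
    ∀ (Y : Type) [AddCommGroup Y] [Module S Y] [Module.Finite S Y], DG S Y (s - e) →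
    HasProjectiveDimensionLT (ModuleCat.of S Y) (n+1) →
    HasProjectiveDimensionLT (ModuleCat.of S Y) (e+1) := by
  induction e with
  | zero =>
    intro Y _ _ _ hY h
    have := ab hS hs n Y hY h
    exact proj_pd inferInstance
  | succ e ih =>
    intro Y _ _ _ hY h
    obtain ⟨m, g, hg⟩ := exists_pres (S := S) Y
    rw [pd_ker g hg]
    apply ih (by omega) _ (DG.ker hS (by omega) (fun j hj => hY j (by omega)) g hg)
    rw [← pd_ker g hg]
    exact hasProjectiveDimensionLT_of_ge _ _ _ (Nat.le_succ (n+1))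
end ab
end

noncomputable section
section regular
set_option linter.unusedSectionVars false
open TensorProduct

lemma tor_symm {S : Type} [CommRing S] {A B C A' B' C' : Type}
    [AddCommGroup A] [Module S A] [AddCommGroup B] [Module S B]
    [AddCommGroup C] [Module S C] [AddCommGroup A'] [Module S A'] [AddCommGroup B'] [Module S B']
    [AddCommGroup C'] [Module S C'] [Module.Flat S B]
    {f : A →ₗ[S] B} {g : B →ₗ[S] C} (hfg : Function.Exact f g) (hg : Function.Surjective g)
    {f' : A' →ₗ[S] B'} {g' : B' →ₗ[S] C'} (hf' : Function.Injective f')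
    (hfg' : Function.Exact f' g') (hg' : Function.Surjective g')
    (h : Function.Injective (f.rTensor C')) : Function.Injective (f'.lTensor C) := by
  rw [injective_iff_map_eq_zero]
  intro x hx
  obtain ⟨y, rfl⟩ := LinearMap.rTensor_surjective A' hg x
  have h1 : g.rTensor B' (f'.lTensor B y) = 0 := by
    rw [← hx, ← LinearMap.comp_apply, ← LinearMap.comp_apply, LinearMap.rTensor_comp_lTensor,
      LinearMap.lTensor_comp_rTensor]
  obtain ⟨w, hw⟩ := (rTensor_exact B' hfg hg _).1 h1
  have h2 : g'.lTensor A w = 0 := by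
    apply h
    rw [map_zero]
    have : f.rTensor C' (g'.lTensor A w) = g'.lTensor B (f.rTensor B' w) := by
      rw [← LinearMap.comp_apply, ← LinearMap.comp_apply, LinearMap.rTensor_comp_lTensor,
        LinearMap.lTensor_comp_rTensor]
    rw [this, hw]
    exact (lTensor_exact B hfg' hg' _).2 ⟨y, rfl⟩
  obtain ⟨u, hu⟩ := (lTensor_exact A hfg' hg' _).1 h2
  have h3 : f.rTensor A' u = y := by
    apply Module.Flat.lTensor_preserves_injective_linearMap (M := B) f' hf'
    rw [← hw, ← hu, ← LinearMap.comp_apply, ← LinearMap.comp_apply, LinearMap.rTensor_comp_lTensor,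
        LinearMap.lTensor_comp_rTensor]
  rw [← h3]
  exact (rTensor_exact A' hfg hg _).2 ⟨u, rfl⟩

variable {S : Type} [CommRing S] [IsNoetherianRing S] [IsLocalRing S]
open IsLocalRing

variable (S) in
/-- freeness as a plain proposition (not a class). -/
def IsFr (L : Type) [AddCommGroup L] [Module S L] : Prop := Module.Free S L

lemma reg_free_aux {s : ℕ} (hS : DG S S s) (hs : ¬ EV S (ResidueField S) S s) (n : ℕ) :
    ∀ (K : Type) [AddCommGroup K] [Module S K] [Module.Finite S K],
    HasProjectiveDimensionLT (ModuleCat.of S K) (n+1) →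
    (∀ (L : Type) [AddCommGroup L] [Module S L] [Module.Finite S L], DG S L s →
      (∀ (m : ℕ) (g : (Fin m → S) →ₗ[S] L), Function.Surjective g →
        Function.Injective ((LinearMap.ker g).subtype.lTensor K)) → IsFr S L) →
    ∀ (L : Type) [AddCommGroup L] [Module S L] [Module.Finite S L], DG S L s →
      IsFr S L := by
  induction n with
  | zero =>
    intro K _ _ _ hK H L _ _ _ hL
    have := pd_proj hK
    refine H L hL fun m g hg => ?_
    exact Module.Flat.lTensor_preserves_injective_linearMap _ (Submodule.injective_subtype _)
  | succ n ih =>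
    intro K _ _ _ hK H
    obtain ⟨a, π, hπ⟩ := exists_pres (S := S) K
    refine ih (LinearMap.ker π) ((pd_ker π hπ n).1 hK) ?_
    intro L _ _ _ hL hT
    obtain ⟨b, g, hg⟩ := exists_pres (S := S) L
    have hker : DG S (LinearMap.ker g) s :=
      DG.ker hS le_rfl (fun j hj => hL j (by omega)) g hg
    have hfree : Module.Free S (LinearMap.ker g) := by
      refine H _ hker fun m q hq => ?_
      refine tor_symm (LinearMap.exact_subtype_ker_map π) hπ (Submodule.injective_subtype _)
        (LinearMap.exact_subtype_ker_map q) hq ?_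
      have h1 : Function.Injective ((LinearMap.ker π).subtype.rTensor (Fin b → S)) :=
        Module.Flat.rTensor_preserves_injective_linearMap _ (Submodule.injective_subtype _)
      have h2 := h1.comp (hT b g hg)
      rw [← LinearMap.coe_comp, LinearMap.rTensor_comp_lTensor,
        ← LinearMap.lTensor_comp_rTensor, LinearMap.coe_comp] at h2
      exact h2.of_comp
    exact ab1 (Submodule.injective_subtype _) (LinearMap.exact_subtype_ker_map g) hg hs hL

lemma pd_of_projDim {S : Type} [CommRing S] {X : ModuleCat S} (h : projDim S X < ⊤) :
    ∃ n : ℕ, HasProjectiveDimensionLT X (n + 1) := by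
  unfold projDim at h
  rw [sInf_lt_iff] at h
  obtain ⟨a, ha, hlt⟩ := h
  lift a to ℕ using hlt.ne
  refine ⟨a, HasProjectiveDimensionLT.mk (fun i hi Y e => ?_)⟩
  have := (extS_iff i X Y).1 (ha i Y (by exact_mod_cast hi))
  exact Subsingleton.elim _ _

lemma reg_free {s : ℕ} (hS : DG S S s) (hs : ¬ EV S (ResidueField S) S s)
    (h : projDim S (ModuleCat.of S (ResidueField S)) < ⊤)
    (L : Type) [AddCommGroup L] [Module S L] [Module.Finite S L] (hL : DG S L s) :
    Module.Free S L := by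
  obtain ⟨n, hn⟩ := pd_of_projDim h
  refine reg_free_aux hS hs n (ResidueField S) hn ?_ L hL
  intro L _ _ _ hL hT
  obtain ⟨b, g, hg⟩ := exists_pres (S := S) L
  exact Module.free_of_lTensor_residueField_injective _ g hg (LinearMap.exact_subtype_ker_map g)
    (hT b g hg)

end regular
end

noncomputable section
section localize
set_option linter.unusedSectionVars false
variable {R : Type} [CommRing R] [IsNoetherianRing R]

lemma EV.loc (T : Submonoid R) (Y : Type) [AddCommGroup Y] [Module R Y] (i : ℕ) :
    ∀ (X : Type) [AddCommGroup X] [Module R X] [Module.Finite R X], EV R X Y i →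
    EV (Localization T) (LocalizedModule T X) (LocalizedModule T Y) i := by
  have key : ∀ (X : Type) [AddCommGroup X] [Module R X] [Module.Finite R X]
      (φ : LocalizedModule T X →ₗ[Localization T] LocalizedModule T Y),
      ∃ (φ' : X →ₗ[R] Y) (s : T), LocalizedModule.map T φ' = s • φ := by
    intro X _ _ _ φ
    have : Module.FinitePresentation R X := Module.finitePresentation_of_finite R X
    obtain ⟨⟨φ', s⟩, h⟩ := IsLocalizedModule.surj T (LocalizedModule.map T (M := X) (N := Y)) φ
    exact ⟨φ', s, h.symm⟩
  have inj : ∀ (X : Type) [AddCommGroup X] [Module R X] [Module.Finite R X] (s : T)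
      , Function.Bijective (fun φ : LocalizedModule T X →ₗ[Localization T] LocalizedModule T Y => s • φ) := by
    intro X _ _ _ s
    have : Module.FinitePresentation R X := Module.finitePresentation_of_finite R X
    have := (Module.End.isUnit_iff _).1
      (IsLocalizedModule.map_units (LocalizedModule.map T (M := X) (N := Y)) s)
    exact this
  induction i with
  | zero =>
    intro X _ _ _ h
    rw [EV.zero_iff] at h ⊢
    have : ∀ φ : LocalizedModule T X →ₗ[Localization T] LocalizedModule T Y, φ = 0 := by
      intro φ
      obtain ⟨φ', s, hs⟩ := key X φ
      rw [h.elim φ' 0, map_zero] at hs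
      apply (inj X s).1
      change s • φ = s • 0
      rw [← hs, smul_zero]
    exact ⟨fun a b => by rw [this a, this b]⟩
  | succ i ih =>
    intro X _ _ _ h
    obtain ⟨n, g, hg⟩ := Module.Finite.exists_fin' R X
    have h1 : Function.Injective (LocalizedModule.map T (LinearMap.ker g).subtype) :=
      LocalizedModule.map_injective T _ (Submodule.injective_subtype _)
    have h2 : Function.Exact (LocalizedModule.map T (LinearMap.ker g).subtype)
      (LocalizedModule.map T g) :=
      LocalizedModule.map_exact T _ _ (LinearMap.exact_subtype_ker_map g)
    have h3 : Function.Surjective (LocalizedModule.map T g) :=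
      LocalizedModule.map_surjective T _ hg
    have hp : Module.Projective (Localization T) (LocalizedModule T (Fin n → R)) := inferInstance
    cases i with
    | zero =>
      refine (EV.one_iff (A := LocalizedModule T (LinearMap.ker g))
        (f := LocalizedModule.map T (LinearMap.ker g).subtype) h1 h2 h3).2 ?_
      replace h := (EV.one_iff (Submodule.injective_subtype _)
        (LinearMap.exact_subtype_ker_map g) hg).1 h
      intro φ
      obtain ⟨φ', s, hs⟩ := key _ φ
      obtain ⟨ψ, rfl⟩ := h φ'
      obtain ⟨ψ', hψ'⟩ := (inj _ s).2 (LocalizedModule.map T ψ)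
      refine ⟨ψ', (inj _ s).1 ?_⟩
      change s • _ = s • _
      rw [← hs]
      change s • ψ' = _ at hψ'
      rw [← LinearMap.smul_comp, hψ']
      ext x
      induction x using LocalizedModule.induction_on with
      | h m t => simp [LocalizedModule.map_mk]
    | succ i =>
      have h4 : EV R (LinearMap.ker g) Y (i+1) :=
        EV.cleft (Submodule.injective_subtype _) (LinearMap.exact_subtype_ker_map g) hg
          EV.proj h
      exact EV.cright h1 h2 h3 (ih _ h4) EV.proj

lemma locModRes (p : Ideal R) [p.IsPrime] :
    Nonempty (IsLocalRing.ResidueField (Localization.AtPrime p) ≃ₗ[Localization.AtPrime p]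
      LocalizedModule p.primeCompl (R ⧸ p)) := by
  have : IsLocalizedModule p.primeCompl
      (IsScalarTower.toAlgHom R (R ⧸ p) p.ResidueField).toLinearMap := by
    rw [isLocalizedModule_iff_isLocalization]
    have h : Algebra.algebraMapSubmonoid (R ⧸ p) p.primeCompl = nonZeroDivisors (R ⧸ p) := by
      ext x
      rw [mem_nonZeroDivisors_iff_ne_zero]
      constructor
      · rintro ⟨y, hy, rfl⟩
        change Ideal.Quotient.mk p y ≠ 0
        rwa [Ne, Ideal.Quotient.eq_zero_iff_mem]
      · intro hx
        obtain ⟨y, rfl⟩ := Ideal.Quotient.mk_surjective x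
        rw [Ne, Ideal.Quotient.eq_zero_iff_mem] at hx
        exact ⟨y, hx, rfl⟩
    rw [h]
    infer_instance
  exact ⟨((IsLocalizedModule.linearEquiv p.primeCompl (LocalizedModule.mkLinearMap p.primeCompl (R ⧸ p))
    (IsScalarTower.toAlgHom R (R ⧸ p) p.ResidueField).toLinearMap).symm).extendScalarsOfIsLocalization
      p.primeCompl (Localization.AtPrime p)⟩

variable [IsLocalRing R]

lemma locFree {d : ℕ} (hd : ringKrullDim R = d) (p : PrimeSpectrum R)
    (hp : projDim (Localization.AtPrime p.asIdeal)
        (ModuleCat.of (Localization.AtPrime p.asIdeal)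
          (IsLocalRing.ResidueField (Localization.AtPrime p.asIdeal))) < ⊤)
    (hR : DG R R d)
    (M : Type) [AddCommGroup M] [Module R M] [Module.Finite R M] (hM : DG R M d) :
    Module.Free (Localization.AtPrime p.asIdeal) (LocalizedModule p.asIdeal.primeCompl M) := by
  have hle : Order.height p + Order.coheight p ≤ (d : ℕ∞) := by
    have h : ringKrullDim R = _ := Order.krullDim_eq_iSup_height_add_coheight_of_nonempty
    rw [hd] at h
    have h' := WithBot.coe_injective h
    rw [h']
    exact le_iSup (fun a : PrimeSpectrum R => Order.height a + Order.coheight a) p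
  have hht : Order.height p ≠ ⊤ := by
    intro h; rw [h, top_add, top_le_iff] at hle; exact ENat.natCast_ne_top _ hle
  have hcht : Order.coheight p ≠ ⊤ := by
    intro h; rw [h, add_top, top_le_iff] at hle; exact ENat.natCast_ne_top _ hle
  obtain ⟨a, ha⟩ := ENat.ne_top_iff_exists.1 hht
  obtain ⟨b, hb⟩ := ENat.ne_top_iff_exists.1 hcht
  rw [← ha, ← hb] at hle
  have hab : a + b ≤ d := by exact_mod_cast hle
  obtain ⟨e⟩ := locModRes p.asIdeal
  have hDG : ∀ (Y : Type) [AddCommGroup Y] [Module R Y] [Module.Finite R Y], DG R Y d →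
      DG (Localization.AtPrime p.asIdeal) (LocalizedModule p.asIdeal.primeCompl Y) a := by
    intro Y _ _ _ hY i hi
    exact EV.congr' e (EV.loc _ Y i _ (ischebeck hY b p hb.symm.le i (by omega)))
  have hdim : ringKrullDim (Localization.AtPrime p.asIdeal) = a := by
    rw [IsLocalization.AtPrime.ringKrullDim_eq_height p.asIdeal, PrimeSpectrum.height_eq_orderHeight, ← ha]
    rfl
  have hex : ∃ s, ¬ EV (Localization.AtPrime p.asIdeal) (IsLocalRing.ResidueField
      (Localization.AtPrime p.asIdeal)) (Localization.AtPrime p.asIdeal) s := by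
    by_contra! hcon
    have h := depth_le_dim (S := Localization.AtPrime p.asIdeal)
      (Y := Localization.AtPrime p.asIdeal) (n := a + 1) (fun i _ => hcon i)
    rw [hdim] at h
    have : a + 1 ≤ a := by exact_mod_cast h
    omega
  classical
  have hmin : DG (Localization.AtPrime p.asIdeal) (Localization.AtPrime p.asIdeal) (Nat.find hex) :=
    fun i hi => not_not.1 (Nat.find_min hex hi)
  have hle2 : Nat.find hex ≤ a := by
    have h := depth_le_dim hmin
    rw [hdim] at h
    exact_mod_cast h
  exact reg_free hmin (Nat.find_spec hex) hp _ ((hDG M hM).mono hle2)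
end localize
end

noncomputable section
section split
set_option linter.unusedSectionVars false
variable {R : Type} [CommRing R] [IsNoetherianRing R]

lemma split_at (T : Submonoid R) {F M : Type} [AddCommGroup F] [Module R F] [Module.Finite R F]
    [AddCommGroup M] [Module R M] [Module.Finite R M] (π : F →ₗ[R] M) (hπ : Function.Surjective π)
    (hfree : Module.Free (Localization T) (LocalizedModule T M)) :
    ∃ s ∈ T, ∃ g : M →ₗ[R] F, π ∘ₗ g = s • LinearMap.id := by
  have : Module.FinitePresentation R M := Module.finitePresentation_of_finite R M
  obtain ⟨σ, hσ⟩ := Module.projective_lifting_property (LocalizedModule.map T π) LinearMap.id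
    (LocalizedModule.map_surjective T _ hπ)
  obtain ⟨⟨g, t⟩, h⟩ := IsLocalizedModule.surj T (LocalizedModule.map T (M := M) (N := F)) σ
  have h' : LocalizedModule.map T g = t • σ := h.symm
  have h2 : LocalizedModule.map T (π ∘ₗ g) = LocalizedModule.map T (t • LinearMap.id) := by
    have h3 : LocalizedModule.map T (π ∘ₗ g) =
        LocalizedModule.map T π ∘ₗ LocalizedModule.map T g := by
      ext x
      induction x using LocalizedModule.induction_on with
      | h m t => simp [LocalizedModule.map_mk]
    rw [h3, h']
    ext x
    have h4 : (LocalizedModule.map T π) (σ x) = x := LinearMap.congr_fun hσ x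
    change (LocalizedModule.map T π) (t.1 • σ x) = _
    rw [LinearMap.map_smul_of_tower, h4]
    induction x using LocalizedModule.induction_on with
      | h m u =>
        rw [LocalizedModule.map_mk, LocalizedModule.smul'_mk]
        rfl
  obtain ⟨c, hc⟩ := IsLocalizedModule.exists_of_eq (S := T) h2
  refine ⟨c.1 * t.1, mul_mem c.2 t.2, c.1 • g, ?_⟩
  rw [LinearMap.comp_smul, mul_smul]
  exact hc

/-- scalars whose homothety factors through `π`. -/
def splitIdeal {F M : Type} [AddCommGroup F] [Module R F]
    [AddCommGroup M] [Module R M] (π : F →ₗ[R] M) : Ideal R where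
  carrier := {s | ∃ g : M →ₗ[R] F, π ∘ₗ g = s • LinearMap.id}
  zero_mem' := ⟨0, by simp⟩
  add_mem' := by
    rintro a b ⟨g, hg⟩ ⟨h, hh⟩
    exact ⟨g + h, by rw [LinearMap.comp_add, hg, hh, add_smul]⟩
  smul_mem' := by
    rintro c a ⟨g, hg⟩
    exact ⟨c • g, by rw [LinearMap.comp_smul, hg, smul_eq_mul, mul_smul]⟩

variable [IsLocalRing R]

lemma split_pow {F M : Type} [AddCommGroup F] [Module R F] [Module.Finite R F]
    [AddCommGroup M] [Module R M] [Module.Finite R M] (π : F →ₗ[R] M) (hπ : Function.Surjective π)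
    (hfree : ∀ p : PrimeSpectrum R, p.asIdeal ≠ IsLocalRing.maximalIdeal R →
      Module.Free (Localization.AtPrime p.asIdeal) (LocalizedModule p.asIdeal.primeCompl M)) :
    ∃ k : ℕ, IsLocalRing.maximalIdeal R ^ k ≤ splitIdeal π := by
  refine Ideal.exists_pow_le_of_le_radical_of_fg ?_ (IsNoetherian.noetherian _)
  rw [Ideal.radical_eq_sInf]
  refine le_sInf ?_
  rintro p ⟨hp, hprime⟩
  by_contra hcon
  obtain ⟨s, hs, g, hg⟩ := split_at p.primeCompl π hπ (hfree ⟨p, hprime⟩ (fun h => hcon h.ge))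
  exact hs (hp ⟨g, hg⟩)

end split
end

noncomputable section
section homdepth
set_option linter.unusedSectionVars false
variable {R : Type} [CommRing R] [IsNoetherianRing R] [IsLocalRing R]
open IsLocalRing

lemma EV.zero_inj {S : Type} [CommRing S] {A B X : Type} [AddCommGroup A] [Module S A]
    [AddCommGroup B] [Module S B] [AddCommGroup X] [Module S X] (f : A →ₗ[S] B)
    (hf : Function.Injective f) (h : EV S X B 0) : EV S X A 0 := by
  rw [EV.zero_iff] at h ⊢
  refine ⟨fun a b => ?_⟩
  have h1 := h.elim (f ∘ₗ a) (f ∘ₗ b)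
  ext x
  exact hf (LinearMap.congr_fun h1 x)

lemma soc_zero {Q : Type} [AddCommGroup Q] [Module R Q] (h : EV R (ResidueField R) Q 0) (k : ℕ) :
    ∀ x : Q, (∀ s ∈ maximalIdeal R ^ k, s • x = 0) → x = 0 := by
  induction k with
  | zero =>
    intro x hx
    simpa using hx 1 (by simp)
  | succ k ih =>
    intro x hx
    rw [EV.zero_iff] at h
    have hm : ∀ r ∈ maximalIdeal R, r • x = 0 := by
      intro r hr
      refine ih _ fun s hs => ?_
      rw [← mul_smul]
      exact hx _ (by rw [pow_succ]; exact Ideal.mul_mem_mul hs hr)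
    let φ : ResidueField R →ₗ[R] Q :=
      Submodule.liftQ (maximalIdeal R) (LinearMap.toSpanSingleton R Q x) (by
        intro r hr
        simpa using hm r hr)
    have h1 : φ (residue R 1) = x := by
      change LinearMap.toSpanSingleton R Q x 1 = x
      simp
    rw [← h1, h.elim φ 0]
    rfl

section
variable {N : Type} [AddCommGroup N] [Module R N]

lemma hom_pi {n i : ℕ} (h : EV R (ResidueField R) N i) :
    EV R (ResidueField R) ((Fin n → R) →ₗ[R] N) i :=
  (h.pi (n := n)).congr (Module.piEquiv (Fin n) R N).symm

variable {Z : Type} [AddCommGroup Z] [Module R Z] [Module.Finite R Z]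

lemma hom_zero (h : EV R (ResidueField R) N 0) : EV R (ResidueField R) (Z →ₗ[R] N) 0 := by
  obtain ⟨n, g, hg⟩ := Module.Finite.exists_fin' R Z
  exact EV.zero_inj (LinearMap.lcomp R N g) (fun a b hab => by
    ext z
    obtain ⟨y, rfl⟩ := hg z
    exact LinearMap.congr_fun hab y) (hom_pi h)

variable {n : ℕ} (g : (Fin n → R) →ₗ[R] Z)

lemma lcomp_inj (hg : Function.Surjective g) : Function.Injective (LinearMap.lcomp R N g) :=
  fun a b hab => by
    ext z
    obtain ⟨y, rfl⟩ := hg z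
    exact LinearMap.congr_fun hab y

lemma lcomp_exact (hg : Function.Surjective g) :
    Function.Exact (LinearMap.lcomp R N g) (LinearMap.lcomp R N (LinearMap.ker g).subtype) := by
  intro φ
  constructor
  · intro h
    have h' : LinearMap.ker g ≤ LinearMap.ker φ := fun x hx => LinearMap.congr_fun h ⟨x, hx⟩
    refine ⟨(LinearMap.ker g).liftQ φ h' ∘ₗ (g.quotKerEquivOfSurjective hg).symm.toLinearMap, ?_⟩
    ext x
    simp
  · rintro ⟨ψ, rfl⟩
    ext x
    simp

lemma hom_range (hg : Function.Surjective g) : Function.Exact (LinearMap.lcomp R N g)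
    (LinearMap.lcomp R N (LinearMap.ker g).subtype).rangeRestrict := by
  intro φ
  rw [← lcomp_exact g hg φ]
  exact Subtype.ext_iff

lemma hom_two (h : DG R N 2) : DG R (Z →ₗ[R] N) 2 := by
  intro i hi
  interval_cases i
  · exact hom_zero (h 0 (by omega))
  · obtain ⟨n, g, hg⟩ := Module.Finite.exists_fin' R Z
    refine EV.left (lcomp_inj g hg) (hom_range g hg) (LinearMap.surjective_rangeRestrict _) ?_
      (hom_pi (h 1 (by omega)))
    exact EV.zero_inj (Submodule.subtype _) (Submodule.injective_subtype _)
      (hom_zero (h 0 (by omega)))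

lemma factor_ker {s : R} (hs : s ∈ splitIdeal g) : ∃ h : (Fin n → R) →ₗ[R] LinearMap.ker g,
    h ∘ₗ (LinearMap.ker g).subtype = s • LinearMap.id := by
  obtain ⟨t, ht⟩ := hs
  refine ⟨LinearMap.codRestrict _ (s • LinearMap.id - t ∘ₗ g) ?_, ?_⟩
  · intro x
    have := LinearMap.congr_fun ht (g x)
    simp at this
    simp [this]
  · ext1 x
    apply Subtype.ext
    have := x.2
    simp

lemma ext_zero (hg : Function.Surjective g) (h : DG R N 2) {k : ℕ}
    (hk : maximalIdeal R ^ k ≤ splitIdeal g) (h2 : EV R (ResidueField R) (Z →ₗ[R] N) 2)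
    (φ : LinearMap.ker g →ₗ[R] N) : ∃ ψ, ψ ∘ₗ (LinearMap.ker g).subtype = φ := by
  have h3 := EV.right (lcomp_inj g hg) (hom_range (N := N) g hg)
    (LinearMap.surjective_rangeRestrict _) (hom_pi (h 1 (by omega))) h2
  let I := LinearMap.range (LinearMap.lcomp R N (LinearMap.ker g).subtype)
  have h4 : EV R (ResidueField R) ((LinearMap.ker g →ₗ[R] N) ⧸ I) 0 :=
    EV.right (f := I.subtype) (g := I.mkQ) (Submodule.injective_subtype _)
      (by rw [LinearMap.exact_iff]; simp) (Submodule.mkQ_surjective _)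
      (hom_zero (h 0 (by omega))) h3
  have h5 := soc_zero h4 k (I.mkQ φ) (fun s hs => by
    rw [← map_smul, Submodule.mkQ_apply, Submodule.Quotient.mk_eq_zero]
    obtain ⟨t, ht⟩ := factor_ker g (hk hs)
    refine ⟨φ ∘ₗ t, ?_⟩
    rw [LinearMap.lcomp_apply', LinearMap.comp_assoc, ht]
    ext x
    simp)
  rw [Submodule.mkQ_apply, Submodule.Quotient.mk_eq_zero] at h5
  exact h5
end
end homdepth
end

noncomputable section
section torbridge
set_option linter.unusedSectionVars false
variable {R : Type} [CommRing R]
open TensorProduct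

lemma sub_comp_rr {A B : Type} [AddCommGroup A] [Module R A] [AddCommGroup B] [Module R B]
    (f : A →ₗ[R] B) : (LinearMap.range f).subtype ∘ₗ f.rangeRestrict = f := rfl

/-- vanishing of `Tor_1(N, X)` from a single flat presentation of `X`. -/
lemma tor_one_zero {A B X N : Type} [AddCommGroup A] [Module R A] [AddCommGroup B] [Module R B]
    [AddCommGroup X] [Module R X] [AddCommGroup N] [Module R N] [Module.Flat R B]
    {f : A →ₗ[R] B} {g : B →ₗ[R] X} (hfg : Function.Exact f g) (hg : Function.Surjective g)
    (h : Function.Injective (f.rTensor N)) :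
    Subsingleton (tor R 1 (ModuleCat.of R N) (ModuleCat.of R X)) := by
  have key : ∀ {A' B' : Type} [AddCommGroup A'] [Module R A'] [AddCommGroup B'] [Module R B']
    {f' : A' →ₗ[R] B'} {g' : B' →ₗ[R] X} (_ : Function.Injective f') (_ : Function.Exact f' g')
    (_ : Function.Surjective g'), Function.Injective (f'.lTensor N) := by
    intro A' B' _ _ _ _ f' g' hf' hfg' hg'
    obtain ⟨p, hp⟩ : ∃ p : (N →₀ R) →ₗ[R] N, Function.Surjective p :=
      ⟨Finsupp.linearCombination R id, Finsupp.linearCombination_id_surjective R N⟩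
    have h1 := tor_symm hfg hg (Submodule.injective_subtype _) (LinearMap.exact_subtype_ker_map p)
      hp h
    refine tor_symm (A := LinearMap.ker p) (B := N →₀ R) (C := N) (f := (LinearMap.ker p).subtype)
      (g := p) (LinearMap.exact_subtype_ker_map p) hp hf' hfg' hg' ?_
    rw [LinearMap.lTensor_inj_iff_rTensor_inj] at h1
    exact h1
  let P := projectiveResolution (ModuleCat.of R X)
  have e := P.isoLeftDerivedObj ((MonoidalCategory.tensoringLeft (ModuleCat R)).obj
    (ModuleCat.of R N)) 1
  refine e.toLinearEquiv.toEquiv.subsingleton_congr.2 ?_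
  change Subsingleton (HomologicalComplex.homology _ 1 : ModuleCat R)
  rw [← ModuleCat.isZero_iff_subsingleton, ← HomologicalComplex.exactAt_iff_isZero_homology,
    HomologicalComplex.exactAt_iff' _ 2 1 0 (by simp) (by simp), ShortComplex.moduleCat_exact_iff]
  intro (x : N ⊗[R] P.complex.X 1) hx
  have hx' : (P.complex.d 1 0).hom.lTensor N x = 0 := hx
  suffices ∃ y, (P.complex.d 2 1).hom.lTensor N y = x from this
  have e0 : Function.Exact (P.complex.d 1 0).hom (P.π.f 0).hom :=
    (ShortComplex.ShortExact.moduleCat_exact_iff_function_exact _).1 P.exact₀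
  have e1 : Function.Exact (P.complex.d 2 1).hom (P.complex.d 1 0).hom :=
    (ShortComplex.ShortExact.moduleCat_exact_iff_function_exact _).1 (P.exact_succ 0)
  have hs : Function.Surjective (P.π.f 0).hom := (ModuleCat.epi_iff_surjective _).1 inferInstance
  let d := (P.complex.d 1 0).hom
  have h1 : Function.Injective ((LinearMap.range d).subtype.lTensor N) := by
    refine key (g' := (P.π.f 0).hom) (Submodule.injective_subtype _) ?_ hs
    intro x
    refine (e0 x).trans ?_
    simp [d]
  have h2 : d.rangeRestrict.lTensor N x = 0 := by
    apply h1
    rw [map_zero, ← LinearMap.lTensor_comp_apply, sub_comp_rr]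
    exact hx'
  have e2 : Function.Exact (P.complex.d 2 1).hom d.rangeRestrict := by
    intro x
    rw [← e1 x]
    exact Subtype.ext_iff
  exact (lTensor_exact N e2 d.surjective_rangeRestrict x).1 h2


/-- the canonical map `A^* ⊗ N → Hom(A, N)`. -/
def dth (A N : Type) [AddCommGroup A] [Module R A] [AddCommGroup N] [Module R N] :
    (A →ₗ[R] R) ⊗[R] N →ₗ[R] (A →ₗ[R] N) := TensorProduct.lift LinearMap.smulRightₗ

lemma dth_nat {A B N : Type} [AddCommGroup A] [Module R A] [AddCommGroup B] [Module R B]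
    [AddCommGroup N] [Module R N]
    (f : A →ₗ[R] B) (y : (B →ₗ[R] R) ⊗[R] N) :
    dth A N ((LinearMap.lcomp R R f).rTensor N y) = dth B N y ∘ₗ f := by
  induction y with
  | zero => simp
  | add a b ha hb => rw [map_add, map_add, ha, hb, map_add, LinearMap.add_comp]
  | tmul φ n =>
    ext x
    simp [dth]

lemma dth_bij {A N : Type} [AddCommGroup A] [Module R A] [Module.Free R A] [Module.Finite R A]
    [AddCommGroup N] [Module R N] :
    Function.Bijective (dth (R := R) A N) :=
  dualTensorHom_bijective

lemma exists_desc {F₁ F₂ L N : Type} [AddCommGroup F₁] [Module R F₁]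
    [AddCommGroup F₂] [Module R F₂] 
    [AddCommGroup L] [Module R L] [AddCommGroup N] [Module R N]
    {u : F₂ →ₗ[R] F₁} {q : F₁ →ₗ[R] L} (hu : Function.Exact u q) (hq : Function.Surjective q)
    (θ : F₁ →ₗ[R] N) (h : θ ∘ₗ u = 0) : ∃ ψ : L →ₗ[R] N, ψ ∘ₗ q = θ := by
  have h' : LinearMap.ker q ≤ LinearMap.ker θ := by
    intro x hx
    obtain ⟨y, rfl⟩ := (hu x).1 hx
    exact LinearMap.congr_fun h y
  refine ⟨(LinearMap.ker q).liftQ θ h' ∘ₗ (q.quotKerEquivOfSurjective hq).symm.toLinearMap, ?_⟩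
  ext x
  simp

section
variable {F₁ F₂ L N D₁ D₂ D I : Type} [AddCommGroup F₁] [Module R F₁]
  [AddCommGroup F₂] [Module R F₂] [AddCommGroup I] [Module R I]
  [AddCommGroup D₁] [Module R D₁] [AddCommGroup D₂] [Module R D₂] [AddCommGroup D] [Module R D]
  [AddCommGroup L] [Module R L] [AddCommGroup N] [Module R N]
  {u : F₂ →ₗ[R] F₁} {q : F₁ →ₗ[R] L}
  {j : I →ₗ[R] D₂} {v : D₁ →ₗ[R] I} {w : D →ₗ[R] D₁}
  {θ₁ : D₁ ⊗[R] N →ₗ[R] (F₁ →ₗ[R] N)} {θ₂ : D₂ ⊗[R] N →ₗ[R] (F₂ →ₗ[R] N)}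
  {θ : D ⊗[R] N →ₗ[R] (L →ₗ[R] N)}

lemma auslander_mp (hu : Function.Exact u q) (hq : Function.Surjective q)
    (hwv : Function.Exact w v) (hv : Function.Surjective v)
    (h₁ : Function.Injective θ₁) 
    (hvu : ∀ y, θ₂ ((j ∘ₗ v).rTensor N y) = θ₁ y ∘ₗ u)
    (hwq : ∀ z, θ₁ (w.rTensor N z) = θ z ∘ₗ q)
    (h : ∀ ψ : L →ₗ[R] N, ∃ z, θ z = ψ) : Function.Injective (j.rTensor N) := by
  rw [injective_iff_map_eq_zero]
  intro x hx
  obtain ⟨y, rfl⟩ := LinearMap.rTensor_surjective N hv x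
  rw [← LinearMap.rTensor_comp_apply] at hx
  have h1 := hvu y
  rw [hx, map_zero] at h1
  obtain ⟨ψ, hψ⟩ := exists_desc hu hq _ h1.symm
  obtain ⟨z, rfl⟩ := h ψ
  rw [← hwq] at hψ
  rw [← h₁ hψ, ← LinearMap.rTensor_comp_apply, hwv.linearMap_comp_eq_zero,
    LinearMap.rTensor_zero, LinearMap.zero_apply]

lemma auslander_mpr (hu : Function.Exact u q) (hq : Function.Surjective q)
    (hwv : Function.Exact w v) (hv : Function.Surjective v)
    (h₁ : Function.Surjective θ₁) (h₂ : Function.Injective θ₂)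
    (hvu : ∀ y, θ₂ ((j ∘ₗ v).rTensor N y) = θ₁ y ∘ₗ u)
    (hwq : ∀ z, θ₁ (w.rTensor N z) = θ z ∘ₗ q)
    (h : Function.Injective (j.rTensor N)) 
    (ψ : L →ₗ[R] N) : ∃ z, θ z = ψ := by
  obtain ⟨y, hy⟩ := h₁ (ψ ∘ₗ q)
  have h1 : (j ∘ₗ v).rTensor N y = 0 := by
    apply h₂
    rw [hvu, hy, map_zero, LinearMap.comp_assoc, hu.linearMap_comp_eq_zero, LinearMap.comp_zero]
  have h2 : v.rTensor N y = 0 := by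
    apply h
    rw [← LinearMap.rTensor_comp_apply, h1, map_zero]
  obtain ⟨z, rfl⟩ := (rTensor_exact N hwv hv y).1 h2
  refine ⟨z, ?_⟩
  rw [hwq] at hy
  ext x
  obtain ⟨a, rfl⟩ := hq x
  exact LinearMap.congr_fun hy a
end

lemma auslander [IsNoetherianRing R] (L : Type) [AddCommGroup L] [Module R L] [Module.Finite R L] :
    ∃ (b c : ℕ) (v : (Fin b → R) →ₗ[R] (Fin c → R)),
      ∀ (N : Type) [AddCommGroup N] [Module R N],
        (∀ ψ : L →ₗ[R] N, ∃ z, dth L N z = ψ) ↔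
          Function.Injective ((LinearMap.range v).subtype.rTensor N) := by
  obtain ⟨b, q, hq⟩ := Module.Finite.exists_fin' R L
  obtain ⟨c, u', hu'⟩ := Module.Finite.exists_fin' R (LinearMap.ker q)
  let u := (LinearMap.ker q).subtype ∘ₗ u'
  have hu : Function.Exact u q := by
    intro x
    constructor
    · intro hx
      obtain ⟨y, hy⟩ := hu' ⟨x, hx⟩
      exact ⟨y, by simp [u, hy]⟩
    · rintro ⟨y, rfl⟩
      exact (u' y).2
  let e₁ : (Fin b → R) ≃ₗ[R] ((Fin b → R) →ₗ[R] R) := Module.piEquiv (Fin b) R R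
  let e₂ : (Fin c → R) ≃ₗ[R] ((Fin c → R) →ₗ[R] R) := Module.piEquiv (Fin c) R R
  let v : (Fin b → R) →ₗ[R] (Fin c → R) :=
    e₂.symm.toLinearMap ∘ₗ LinearMap.lcomp R R u ∘ₗ e₁.toLinearMap
  let w : (L →ₗ[R] R) →ₗ[R] (Fin b → R) := e₁.symm.toLinearMap ∘ₗ LinearMap.lcomp R R q
  refine ⟨b, c, v, fun N _ _ => ?_⟩
  let θ₁ : (Fin b → R) ⊗[R] N →ₗ[R] ((Fin b → R) →ₗ[R] N) :=
    dth _ N ∘ₗ e₁.toLinearMap.rTensor N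
  let θ₂ : (Fin c → R) ⊗[R] N →ₗ[R] ((Fin c → R) →ₗ[R] N) :=
    dth _ N ∘ₗ e₂.toLinearMap.rTensor N
  have b₁ : Function.Bijective θ₁ := dth_bij.comp (e₁.rTensor N).bijective
  have b₂ : Function.Bijective θ₂ := dth_bij.comp (e₂.rTensor N).bijective
  have hwv : Function.Exact w v.rangeRestrict := by
    intro φ
    constructor
    · intro h
      have h1 : e₂.symm (LinearMap.lcomp R R u (e₁ φ)) = 0 := congrArg Subtype.val h
      rw [LinearEquiv.map_eq_zero_iff] at h1
      obtain ⟨ψ, hψ⟩ := exists_desc hu hq (e₁ φ) h1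
      refine ⟨ψ, ?_⟩
      change e₁.symm (ψ ∘ₗ q) = φ
      rw [hψ, LinearEquiv.symm_apply_apply]
    · rintro ⟨ψ, rfl⟩
      apply Subtype.ext
      change e₂.symm (e₁ (e₁.symm (ψ ∘ₗ q)) ∘ₗ u) = 0
      rw [LinearEquiv.apply_symm_apply, LinearMap.comp_assoc, hu.linearMap_comp_eq_zero,
        LinearMap.comp_zero, map_zero]
  have hvu : ∀ y, θ₂ (((LinearMap.range v).subtype ∘ₗ v.rangeRestrict).rTensor N y) =
      θ₁ y ∘ₗ u := by
    intro y
    rw [sub_comp_rr]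
    change dth _ N (e₂.toLinearMap.rTensor N (v.rTensor N y)) = dth _ N _ ∘ₗ u
    rw [← dth_nat, ← LinearMap.rTensor_comp_apply, ← LinearMap.rTensor_comp_apply]
    congr 3
    ext1 x
    simp [v]
  have hwq : ∀ z, θ₁ (w.rTensor N z) = dth L N z ∘ₗ q := by
    intro z
    rw [← dth_nat]
    change dth _ N (e₁.toLinearMap.rTensor N (w.rTensor N z)) = _
    rw [← LinearMap.rTensor_comp_apply]
    congr 3
    ext1 x
    simp [w]
  exact ⟨auslander_mp hu hq hwv v.surjective_rangeRestrict b₁.1 hvu hwq,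
    auslander_mpr hu hq hwv v.surjective_rangeRestrict b₁.2 b₂.1 hvu hwq⟩

end torbridge
end

noncomputable section
section final
set_option linter.unusedSectionVars false
open TensorProduct IsLocalRing
variable {R : Type} [CommRing R] [IsNoetherianRing R] [IsLocalRing R]
variable {L F : Type} [AddCommGroup L] [Module R L] [AddCommGroup F] [Module R F]

lemma EV.finTensor {a i : ℕ} (h : EV R (ResidueField R) L i) :
    EV R (ResidueField R) ((Fin a → R) ⊗[R] L) i :=
  (h.pi (n := a)).congr ((TensorProduct.comm R _ _).trans (TensorProduct.piScalarRight R R L (Fin a)))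

lemma tensor_inj [Module.Flat R F] (ι : L →ₗ[R] F) {k : ℕ}
    (hfac : ∀ s ∈ maximalIdeal R ^ k, ∃ h : F →ₗ[R] L, h ∘ₗ ι = s • LinearMap.id)
    {A G : Type} [AddCommGroup A] [Module R A] [AddCommGroup G] [Module R G] (f : A →ₗ[R] G)
    (hf : Function.Injective f) (h0 : EV R (ResidueField R) (A ⊗[R] L) 0) :
    Function.Injective (f.rTensor L) := by
  rw [injective_iff_map_eq_zero]
  intro x hx
  refine soc_zero h0 k x fun s hs => ?_
  obtain ⟨h, hh⟩ := hfac s hs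
  have h1 : ι.lTensor A x = 0 := by
    apply Module.Flat.rTensor_preserves_injective_linearMap (M := F) f hf
    rw [map_zero, ← LinearMap.comp_apply, LinearMap.rTensor_comp_lTensor,
      ← LinearMap.lTensor_comp_rTensor, LinearMap.comp_apply, hx, map_zero]
  have h2 : (h ∘ₗ ι).lTensor A x = 0 := by
    rw [LinearMap.lTensor_comp_apply, h1, map_zero]
  rw [hh, LinearMap.lTensor_smul, LinearMap.lTensor_id] at h2
  exact h2

lemma tensor_depth [Module.Flat R F] (ι : L →ₗ[R] F) {k d : ℕ}
    (hfac : ∀ s ∈ maximalIdeal R ^ k, ∃ h : F →ₗ[R] L, h ∘ₗ ι = s • LinearMap.id)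
    (hL : DG R L d) (n : ℕ) (hn : n ≤ d) :
    ∀ (Y : Type) [AddCommGroup Y] [Module R Y] [Module.Finite R Y],
    HasProjectiveDimensionLT (ModuleCat.of R Y) (n + 1) → DG R (Y ⊗[R] L) (d - n) := by
  induction n with
  | zero =>
    intro Y _ _ _ h
    have := pd_proj h
    have hfree : Module.Free R Y := Module.free_of_flat_of_isLocalRing
    intro i hi
    let b := Module.finBasis R Y
    exact (EV.finTensor (a := Module.finrank R Y) (hL i hi)).congr
      (TensorProduct.congr b.equivFun (LinearEquiv.refl R L))
  | succ n ih =>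
    intro Y _ _ _ h i hi
    obtain ⟨a, g, hg⟩ := exists_pres (S := R) Y
    have hk := ih (by omega) (LinearMap.ker g) ((pd_ker g hg n).1 h)
    have hinj := tensor_inj ι hfac (LinearMap.ker g).subtype (Submodule.injective_subtype _)
      (hk 0 (by omega))
    exact EV.right hinj (rTensor_exact L (LinearMap.exact_subtype_ker_map g) hg)
      (LinearMap.rTensor_surjective L hg) (EV.finTensor (hL i (by omega))) (hk (i+1) (by omega))

lemma free_of_ev {d k n : ℕ} (hd : 2 ≤ d) (hR : DG R R d) (hR' : ¬ EV R (ResidueField R) R d)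
    {M N : Type} [AddCommGroup M] [Module R M] [Module.Finite R M]
    [AddCommGroup N] [Module R N] (hM : DG R M d) (hN : DG R N 2)
    (hsr : StronglyRigid R (ModuleCat.of R N))
    (g : (Fin n → R) →ₗ[R] M) (hg : Function.Surjective g)
    (hk : maximalIdeal R ^ k ≤ splitIdeal g)
    (h2 : EV R (ResidueField R) (M →ₗ[R] N) 2) : Module.Free R M := by
  obtain ⟨b, c, v, hv⟩ := auslander (R := R) (LinearMap.ker g)
  have hinjN := (hv N).1 (fun ψ => by
    obtain ⟨ψ', rfl⟩ := ext_zero g hg hN hk h2 ψ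
    obtain ⟨z, rfl⟩ := (dth_bij : Function.Bijective (dth (R := R) (Fin n → R) N)).2 ψ'
    exact ⟨_, dth_nat (LinearMap.ker g).subtype z⟩)
  let X := (Fin c → R) ⧸ LinearMap.range v
  have hex : Function.Exact (LinearMap.range v).subtype (LinearMap.range v).mkQ :=
    LinearMap.exact_subtype_mkQ _
  have hXs : Subsingleton (tor R 1 (ModuleCat.of R N) (ModuleCat.of R X)) :=
    tor_one_zero hex (Submodule.mkQ_surjective _) hinjN
  have hfX : Module.Finite R X := inferInstance
  obtain ⟨e, he⟩ := pd_of_projDim (hsr (ModuleCat.of R X) hfX 1 le_rfl hXs)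
  have hX : HasProjectiveDimensionLT (ModuleCat.of R X) (d + 1) :=
    pd_le hR hR' e d le_rfl X (fun i hi => by omega) he
  obtain ⟨d', rfl⟩ : ∃ d', d = d' + 1 := ⟨d - 1, by omega⟩
  have hfac : ∀ s ∈ maximalIdeal R ^ k, ∃ h : (Fin n → R) →ₗ[R] LinearMap.ker g,
      h ∘ₗ (LinearMap.ker g).subtype = s • LinearMap.id := fun s hs => factor_ker g (hk hs)
  have hL : DG R (LinearMap.ker g) (d'+1) :=
    DG.ker hR le_rfl (fun j hj => hM j (by omega)) g hg
  have hkX := (pd_ker (LinearMap.range v).mkQ (Submodule.mkQ_surjective _) d').1 hX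
  have hd1 := tensor_depth _ hfac hL d' (by omega) _ hkX 0 (by omega)
  rw [Submodule.ker_mkQ] at hd1
  have hinjL := tensor_inj _ hfac (LinearMap.range v).subtype (Submodule.injective_subtype _) hd1
  obtain ⟨z, hz⟩ := (hv (LinearMap.ker g)).2 hinjL LinearMap.id
  have hproj : Module.Projective R (LinearMap.ker g) :=
    Module.Projective.of_one_mem_range_dualTensorHom ⟨z, hz⟩
  exact ab hR hR' 1 M hM ((pd_ker g hg 0).2 (proj_pd hproj))

lemma depth_DG {n : ℕ} {Y : ModuleCat R} (h : (n : ℕ∞) ≤ depth R Y) : DG R Y n := by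
  intro i hi
  by_contra hc
  have h1 : depth R Y ≤ i := sInf_le ⟨i, rfl, fun h => hc ((extS_iff i _ _).1 h)⟩
  have := h.trans h1
  rw [Nat.cast_le] at this
  omega

lemma depth_ev {n : ℕ} {Y : ModuleCat R} (h : depth R Y = n) : ¬ EV R (ResidueField R) Y n := by
  intro hc
  have h1 : ((n + 1 : ℕ) : ℕ∞) ≤ depth R Y := by
    refine le_sInf ?_
    rintro _ ⟨i, rfl, hi⟩
    rw [Nat.cast_le]
    by_contra hlt
    rcases Nat.lt_or_ge i n with h' | h'
    · exact hi ((extS_iff i _ _).2 (depth_DG (Y := Y) h.ge i h'))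
    · obtain rfl : i = n := by omega
      exact hi ((extS_iff i _ _).2 hc)
  rw [h, Nat.cast_le] at h1
  omega

lemma depth_eq {n : ℕ} {Y : ModuleCat R} (h : DG R Y n) (h' : ¬ EV R (ResidueField R) Y n) :
    depth R Y = n := by
  apply le_antisymm
  · exact sInf_le ⟨n, rfl, fun h => h' ((extS_iff n _ _).1 h)⟩
  · refine le_sInf ?_
    rintro _ ⟨i, rfl, hi⟩
    rw [Nat.cast_le]
    by_contra hlt
    exact hi ((extS_iff i _ _).2 (h i (by omega)))

end final

end

/-- over a Cohen-Macaulay local ring with isolated singularity,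
if `M` is a nonfree maximal Cohen-Macaulay module and `N` is strongly-rigid
with `depth N ≥ 2`, then `depth Hom_R(M,N) = 2`. -/
theorem stmt19 [IsNoetherianRing R] [IsLocalRing R]
    (hCMring : (depth R (ModuleCat.of R R) : WithBot ℕ∞) = ringKrullDim R)
    (hisol : ∀ p : PrimeSpectrum R, p.asIdeal ≠ IsLocalRing.maximalIdeal R →
      projDim (Localization.AtPrime p.asIdeal)
        (ModuleCat.of (Localization.AtPrime p.asIdeal)
          (IsLocalRing.ResidueField (Localization.AtPrime p.asIdeal))) < ⊤)
    (M N : ModuleCat R) [Module.Finite R M] [Module.Finite R N]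
    (hM : Nontrivial M) (hN : Nontrivial N)
    (hMnonfree : ¬ Module.Free R M)
    (hmcm : (depth R M : WithBot ℕ∞) = ringKrullDim R)
    (hsr : StronglyRigid R N) (hdepthN : 2 ≤ depth R N) :
    depth R (ModuleCat.of R (M →ₗ[R] N)) = 2 := by
  obtain ⟨d, hd⟩ : ∃ d : ℕ, ringKrullDim R = d := by
    obtain ⟨d, hd⟩ := WithBot.ne_bot_iff_exists.1 (ringKrullDim_ne_bot (R := R))
    have ht := ringKrullDim_ne_top (R := R)
    rw [← hd] at ht
    have ht' : d ≠ ⊤ := fun h => ht (by rw [h]; rfl)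
    obtain ⟨e, he⟩ := ENat.ne_top_iff_exists.1 ht'
    exact ⟨e, by rw [← hd, ← he]; rfl⟩
  have hR1 : depth R (ModuleCat.of R R) = d := by
    rw [hd] at hCMring
    exact_mod_cast hCMring
  have hM1 : depth R M = d := by
    rw [hd] at hmcm
    exact_mod_cast hmcm
  have hDR : DG R R d := depth_DG (Y := ModuleCat.of R R) hR1.ge
  have hDR' : ¬ EV R (IsLocalRing.ResidueField R) R d := depth_ev (Y := ModuleCat.of R R) hR1
  have hDM : DG R M d := depth_DG hM1.ge
  have hDN : DG R N 2 := depth_DG hdepthN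
  have hd2 : 2 ≤ d := by
    have := depth_le_dim hDN
    rw [hd] at this
    exact_mod_cast this
  obtain ⟨n, g, hg⟩ := exists_pres (S := R) M
  obtain ⟨k, hk⟩ := split_pow g hg (fun p hp => locFree hd p (hisol p hp) hDR M hDM)
  exact depth_eq (n := 2) (hom_two hDN) fun h2 =>
    hMnonfree (free_of_ev hd2 hDR hDR' hDM hDN hsr g hg hk h2)
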